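/- arXiv:2310.07383 — 8 statements merged into one kernel-verified Lean document; each statement's English description precedes it below -/
import Mathlib

section
/- For every natural number k, the Hirzebruch number h_k = ∏_{p prime} p^⌊k/(p-1)⌋ equals the least common multiple, over all partitions λ = (λ_1,…,λ_l) of k, of the products (λ_1+1)!·(λ_2+1)!·⋯·(λ_l+1)!. -/
/-- The Hirzebruch number `h k = ∏_{p prime} p ^ ⌊k/(p-1)⌋` (primes `p > k+1`
contribute exponent `0`, so the product is over primes `p ≤ k+1`). -/
def hirzebruch (k : ℕ) : ℕ :=
  ∏ p ∈ Finset.filter Nat.Prime (Finset.range (k + 2)), p ^ (k / (p - 1))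

theorem hirz_factorial_dvd (N n : ℕ) (h : n + 1 < N) :
    (n + 1).factorial ∣ ∏ p ∈ Finset.filter Nat.Prime (Finset.range N), p ^ (n / (p - 1)) := by
  have hne : (n + 1).factorial ≠ 0 := Nat.factorial_ne_zero _
  rw [← Nat.prod_factorization_pow_eq_self hne, Nat.prod_factorization_eq_prod_primeFactors]
  have hsub : (n + 1).factorial.primeFactors ⊆ Finset.filter Nat.Prime (Finset.range N) := by
    intro p hp
    have hp' := Nat.prime_of_mem_primeFactors hp
    have h2 := (hp'.dvd_factorial).1 (Nat.dvd_of_mem_primeFactors hp)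
    simp only [Finset.mem_filter, Finset.mem_range]
    exact ⟨by omega, hp'⟩
  refine dvd_trans ?_ (Finset.prod_dvd_prod_of_subset _ _ _ hsub)
  refine Finset.prod_dvd_prod_of_dvd _ _ fun p hp => ?_
  have hp' := Nat.prime_of_mem_primeFactors hp
  have : Fact p.Prime := ⟨hp'⟩
  apply pow_dvd_pow
  rw [Nat.factorization_def _ hp', Nat.le_div_iff_mul_le (Nat.sub_pos_of_lt hp'.one_lt)]
  have := sub_one_mul_padicValNat_factorial_lt_of_ne_zero p (Nat.succ_ne_zero n)
  rw [mul_comm]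
  exact Nat.lt_succ_iff.1 this

theorem hirz_multiset_dvd (N : ℕ) (s : Multiset ℕ) (h : ∀ i ∈ s, i + 1 < N) :
    (s.map (fun i => Nat.factorial (i + 1))).prod ∣
      ∏ p ∈ Finset.filter Nat.Prime (Finset.range N), p ^ (s.sum / (p - 1)) := by
  induction s using Multiset.induction_on with
  | empty => simp
  | cons a s ih =>
    rw [Multiset.map_cons, Multiset.prod_cons, Multiset.sum_cons]
    refine dvd_trans (mul_dvd_mul (hirz_factorial_dvd N a (h a (by simp)))
      (ih fun i hi => h i (by simp [hi]))) ?_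
    rw [← Finset.prod_mul_distrib]
    refine Finset.prod_dvd_prod_of_dvd _ _ fun p hp => ?_
    rw [← pow_add]
    exact pow_dvd_pow _ Nat.div_add_div_le_add_div

/-- The Hirzebruch number `h k` equals the least common multiple over all partitions
`λ = (λ₁, …, λ_l)` of `k` of the products `(λ₁+1)! ⋯ (λ_l+1)!`. -/
theorem hirzebruch_eq_lcm_factorials (k : ℕ) :
    hirzebruch k =
      (Finset.univ : Finset (Nat.Partition k)).lcm
        (fun P => (P.parts.map (fun i => Nat.factorial (i + 1))).prod) := by
  apply Nat.dvd_antisymm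
  · refine Finset.prod_dvd_of_isRelPrime ?_ ?_
    · intro p hp q hq hpq
      simp only [Finset.coe_filter, Set.mem_ofPred_eq] at hp hq
      exact Nat.coprime_iff_isRelPrime.1
        (Nat.Coprime.pow _ _ ((Nat.coprime_primes hp.2 hq.2).2 hpq))
    · intro p hp
      have hp' : p.Prime := (Finset.mem_filter.1 hp).2
      have h2 := hp'.two_le
      let P : Nat.Partition k :=
        { parts := Multiset.replicate (k / (p - 1)) (p - 1)
            + Multiset.replicate (k % (p - 1)) 1
          parts_pos := by
            intro i hi
            rcases Multiset.mem_add.1 hi with hi | hi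
            · rw [Multiset.eq_of_mem_replicate hi]; omega
            · rw [Multiset.eq_of_mem_replicate hi]; omega
          parts_sum := by
            simp [Multiset.sum_replicate, Nat.div_add_mod'] }
      refine dvd_trans ?_ (Finset.dvd_lcm (Finset.mem_univ P))
      simp only [P, Multiset.map_add, Multiset.prod_add, Multiset.map_replicate,
        Multiset.prod_replicate]
      refine Dvd.dvd.mul_right (pow_dvd_pow_of_dvd ?_ _) _
      rw [Nat.sub_add_cancel hp'.one_le]
      exact Nat.dvd_factorial hp'.pos le_rfl
  · refine Finset.lcm_dvd fun P _ => ?_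
    have := hirz_multiset_dvd (k + 2) P.parts
      (fun i hi => by have := Nat.Partition.le_of_mem_parts hi; omega)
    rwa [P.parts_sum] at this
end

section
/- For every natural number k, the Hirzebruch number h_k = ∏_{p prime} p^⌊k/(p-1)⌋ equals the least common multiple, over all partitions λ = (λ_1,…,λ_l) of k, of the products (λ_1+1)·(λ_2+1)·⋯·(λ_l+1). -/
theorem hirz_ext (k N : ℕ) (h : k + 2 ≤ N) :
    hirzebruch k = ∏ p ∈ Finset.filter Nat.Prime (Finset.range N), p ^ (k / (p - 1)) := by
  unfold hirzebruch
  apply Finset.prod_subset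
  · intro p hp
    simp only [Finset.mem_filter, Finset.mem_range] at hp ⊢
    exact ⟨by omega, hp.2⟩
  · intro p hp hn
    simp only [Finset.mem_filter, Finset.mem_range, not_and] at hp hn
    have : ¬ p < k + 2 := fun h' => hn h' hp.2
    rw [Nat.div_eq_of_lt (by omega), pow_zero]

theorem hirz_mul_dvd (a b : ℕ) : hirzebruch a * hirzebruch b ∣ hirzebruch (a + b) := by
  rw [hirz_ext a (a + b + 2) (by omega), hirz_ext b (a + b + 2) (by omega),
    ← Finset.prod_mul_distrib]
  unfold hirzebruch
  apply Finset.prod_dvd_prod_of_dvd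
  intro p _
  rw [← pow_add]
  exact pow_dvd_pow _ (Nat.add_div_le_add_div _ _ _)

theorem succ_dvd_hirz (i : ℕ) : i + 1 ∣ hirzebruch i := by
  have h0 : i + 1 ≠ 0 := by omega
  have key : (i + 1) = ∏ p ∈ (i + 1).primeFactors, p ^ (i + 1).factorization p :=
    (Nat.prod_factorization_pow_eq_self h0).symm
  have h1 : ∏ p ∈ (i + 1).primeFactors, p ^ (i + 1).factorization p ∣
      ∏ p ∈ (i + 1).primeFactors, p ^ (i / (p - 1)) := by
    apply Finset.prod_dvd_prod_of_dvd
    intro p hp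
    have hpp := Nat.prime_of_mem_primeFactors hp
    apply pow_dvd_pow
    have h2 := hpp.two_le
    rw [Nat.le_div_iff_mul_le (by omega)]
    have hle : p ^ (i + 1).factorization p ≤ i + 1 :=
      Nat.le_of_dvd (by omega) (Nat.ordProj_dvd _ _)
    generalize (i + 1).factorization p = v at *
    obtain ⟨q, rfl⟩ : ∃ q, p = q + 1 := ⟨p - 1, by omega⟩
    have hb : 1 + v * q ≤ (1 + q) ^ v := one_add_mul_le_pow_of_sq_nonneg
      (by positivity) (by positivity) (by positivity) v
    rw [add_comm 1 q] at hb
    simp only [Nat.add_sub_cancel]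
    omega
  have h3 : ∏ p ∈ (i + 1).primeFactors, p ^ (i / (p - 1)) ∣ hirzebruch i := by
    unfold hirzebruch
    apply Finset.prod_dvd_prod_of_subset
    intro p hp
    simp only [Finset.mem_filter, Finset.mem_range]
    have := Nat.le_of_mem_primeFactors hp
    exact ⟨by omega, Nat.prime_of_mem_primeFactors hp⟩
  exact (dvd_of_eq key).trans (h1.trans h3)

theorem prod_dvd_hirz (s : Multiset ℕ) :
    (s.map (fun i => i + 1)).prod ∣ hirzebruch s.sum := by
  induction s using Multiset.induction_on with
  | empty => simp
  | cons a s ih =>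
    rw [Multiset.map_cons, Multiset.prod_cons, Multiset.sum_cons]
    exact (mul_dvd_mul (succ_dvd_hirz a) ih).trans (hirz_mul_dvd _ _)

theorem prime_pow_dvd_part (k p : ℕ) (hp : p.Prime) :
    ∃ P : Nat.Partition k, p ^ (k / (p - 1)) ∣ (P.parts.map (fun i => i + 1)).prod := by
  have h2 := hp.two_le
  refine ⟨⟨Multiset.replicate (k / (p - 1)) (p - 1) + Multiset.replicate (k % (p - 1)) 1,
    ?_, ?_⟩, ?_⟩
  · intro i hi
    rcases Multiset.mem_add.1 hi with h | h
    · have := Multiset.eq_of_mem_replicate h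
      omega
    · have := Multiset.eq_of_mem_replicate h
      omega
  · simp only [Multiset.sum_add, Multiset.sum_replicate, smul_eq_mul, mul_one]
    rw [mul_comm]
    exact Nat.div_add_mod k (p - 1)
  · simp only [Multiset.map_add, Multiset.map_replicate, Multiset.prod_add,
      Multiset.prod_replicate]
    rw [Nat.sub_add_cancel (by omega)]
    exact dvd_mul_right _ _

/-- The Hirzebruch number `h k` equals the least common multiple over all partitions
`λ = (λ₁, …, λ_l)` of `k` of the products `(λ₁+1) ⋯ (λ_l+1)`. -/
theorem hirzebruch_eq_lcm_products (k : ℕ) :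
    hirzebruch k =
      (Finset.univ : Finset (Nat.Partition k)).lcm
        (fun P => (P.parts.map (fun i => i + 1)).prod) := by
  apply Nat.dvd_antisymm
  · unfold hirzebruch
    apply Finset.prod_dvd_of_isRelPrime
    · intro p hp q hq hpq
      simp only [Finset.coe_filter, Set.mem_setOf_eq] at hp hq
      exact Nat.coprime_iff_isRelPrime.1
        (Nat.Coprime.pow _ _ ((Nat.coprime_primes hp.2 hq.2).2 hpq))
    · intro p hp
      obtain ⟨P, hP⟩ := prime_pow_dvd_part k p (Finset.mem_filter.1 hp).2
      exact hP.trans (Finset.dvd_lcm (f := fun P : Nat.Partition k =>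
        (P.parts.map (fun i => i + 1)).prod) (Finset.mem_univ P))
  · apply Finset.lcm_dvd
    intro P _
    have := prod_dvd_hirz P.parts
    rwa [P.parts_sum] at this
end

section
/- For every natural number k, the least common multiple over all partitions λ = (λ_1,…,λ_l) of k of the products (λ_1+1)!·⋯·(λ_l+1)! is equal to the least common multiple over all partitions λ of k of the products (λ_1+1)·⋯·(λ_l+1). -/
theorem aux_val (p : ℕ) [hp : Fact p.Prime] (s : Multiset ℕ) :
    (s.map (fun i => Nat.factorial (i + 1))).prod ≠ 0 ∧
    (p - 1) * padicValNat p (s.map (fun i => Nat.factorial (i + 1))).prod ≤ s.sum := by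
  induction s using Multiset.induction_on with
  | empty => simp
  | cons a s ih =>
    obtain ⟨h0, h1⟩ := ih
    have ha := Nat.factorial_ne_zero (a + 1)
    rw [Multiset.map_cons, Multiset.prod_cons, Multiset.sum_cons]
    refine ⟨mul_ne_zero ha h0, ?_⟩
    rw [padicValNat.mul ha h0, mul_add]
    have h2 := sub_one_mul_padicValNat_factorial_lt_of_ne_zero p (n := a + 1) (by omega)
    omega

theorem aux_filter (s : Multiset ℕ) :
    ((s.filter (· ≠ 0)).map (fun i => i + 1)).prod = (s.map (fun i => i + 1)).prod := by
  induction s using Multiset.induction_on with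
  | empty => simp
  | cons a s ih =>
    by_cases h : a = 0
    · subst h
      rw [Multiset.filter_cons_of_neg _ (by simp), ih]
      simp
    · rw [Multiset.filter_cons_of_pos (p := (· ≠ 0)) _ h]
      simp only [Multiset.map_cons, Multiset.prod_cons, ih]

/-- The least common multiple over all partitions `λ = (λ₁, …, λ_l)` of `k` of the
products `(λ₁+1)! ⋯ (λ_l+1)!` equals the least common multiple over all partitions of `k`
of the products `(λ₁+1) ⋯ (λ_l+1)`. -/
theorem lcm_factorials_eq_lcm_products (k : ℕ) :
    (Finset.univ : Finset (Nat.Partition k)).lcm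
        (fun P => (P.parts.map (fun i => Nat.factorial (i + 1))).prod) =
      (Finset.univ : Finset (Nat.Partition k)).lcm
        (fun P => (P.parts.map (fun i => i + 1)).prod) := by
  apply Nat.dvd_antisymm
  · refine Finset.lcm_dvd fun P _ => ?_
    rw [Nat.dvd_iff_prime_pow_dvd_dvd]
    intro p e hp he
    have : Fact p.Prime := ⟨hp⟩
    obtain ⟨h0, h1⟩ := aux_val p P.parts
    rw [P.parts_sum] at h1
    have h2 := (padicValNat_dvd_iff_le h0).1 he
    have h3 : e * (p - 1) ≤ k := by
      rw [mul_comm]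
      exact (Nat.mul_le_mul_left _ h2).trans h1
    let Q := Nat.Partition.ofSums k ((k - e * (p - 1)) ::ₘ Multiset.replicate e (p - 1))
      (by simp; omega)
    refine dvd_trans ?_ (Finset.dvd_lcm (Finset.mem_univ Q))
    have hQ : (Q.parts.map (fun i => i + 1)).prod = (k - e * (p - 1) + 1) * p ^ e := by
      have := aux_filter ((k - e * (p - 1)) ::ₘ Multiset.replicate e (p - 1))
      refine this.trans ?_
      simp [Nat.sub_add_cancel hp.one_le]
    exact hQ ▸ dvd_mul_left _ _
  · refine Finset.lcm_dvd fun P _ => ?_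
    refine dvd_trans ?_ (Finset.dvd_lcm (Finset.mem_univ P))
    exact Multiset.prod_dvd_prod_of_dvd _ _ fun i _ => Nat.dvd_factorial (by omega) le_rfl
end

section
/- For every prime p and every natural number k, the p-adic valuation of the least common multiple, over all partitions λ = (λ_1,…,λ_l) of k, of the products (λ_1+1)·⋯·(λ_l+1), equals ⌊k/(p-1)⌋. -/
theorem aux_single (p n : ℕ) (hp : p.Prime) : (n + 1).factorization p * (p - 1) ≤ n := by
  have h1 : p ^ (n + 1).factorization p ≤ n + 1 :=
    Nat.le_of_dvd (Nat.succ_pos n) (Nat.ordProj_dvd (n + 1) p)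
  have h2 : ∀ v : ℕ, v * (p - 1) + 1 ≤ p ^ v := by
    obtain ⟨q, rfl⟩ : ∃ q, p = q + 1 := ⟨p - 1, by have := hp.pos; omega⟩
    intro v
    induction v with
    | zero => simp
    | succ v ih =>
      simp only [Nat.add_sub_cancel] at ih ⊢
      rw [pow_succ]
      nlinarith [Nat.zero_le (v * q * q)]
  have := h2 ((n + 1).factorization p)
  omega

theorem aux_ne (s : Multiset ℕ) : (s.map (fun i => i + 1)).prod ≠ 0 := by
  simp [Multiset.prod_eq_zero_iff]

theorem aux_multi (p : ℕ) (hp : p.Prime) (s : Multiset ℕ) :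
    ((s.map (fun i => i + 1)).prod).factorization p * (p - 1) ≤ s.sum := by
  induction s using Multiset.induction_on with
  | empty => simp
  | cons a s ih =>
    rw [Multiset.map_cons, Multiset.prod_cons, Multiset.sum_cons,
      Nat.factorization_mul (Nat.succ_ne_zero a) (aux_ne s), Finsupp.add_apply, add_mul]
    exact add_le_add (aux_single p a hp) ih

/-- For every prime `p` and every natural number `k`, the `p`-adic valuation of the
least common multiple over all partitions `λ = (λ₁, …, λ_l)` of `k` of the products
`(λ₁+1) ⋯ (λ_l+1)` equals `⌊k/(p-1)⌋`. -/
theorem padicValNat_lcm_products (p k : ℕ) (hp : p.Prime) :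
    padicValNat p
        ((Finset.univ : Finset (Nat.Partition k)).lcm
          (fun P => (P.parts.map (fun i => i + 1)).prod)) =
      k / (p - 1) := by
  have hp1 : 0 < p - 1 := by have := hp.two_le; omega
  have hL : (Finset.univ : Finset (Nat.Partition k)).lcm
          (fun P => (P.parts.map (fun i => i + 1)).prod) ≠ 0 := by
    rw [Ne, Finset.lcm_eq_zero_iff]
    rintro ⟨P, -, h⟩
    exact aux_ne _ h
  haveI : Fact p.Prime := ⟨hp⟩
  apply le_antisymm
  · rw [← Nat.factorization_def _ hp, Finset.factorization_lcm (fun P _ => aux_ne P.parts)]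
    apply Finset.sup_le
    intro P _
    rw [Nat.le_div_iff_mul_le hp1]
    exact (aux_multi p hp P.parts).trans P.parts_sum.le
  · rw [← padicValNat_dvd_iff_le hL]
    let P : Nat.Partition k :=
      { parts := Multiset.replicate (k / (p - 1)) (p - 1) + Multiset.replicate (k % (p - 1)) 1
        parts_pos := by
          intro i hi
          rcases Multiset.mem_add.1 hi with h | h
          · rw [Multiset.eq_of_mem_replicate h]; exact hp1
          · rw [Multiset.eq_of_mem_replicate h]; exact one_pos
        parts_sum := by
          simp only [Multiset.sum_add, Multiset.sum_replicate, smul_eq_mul, mul_one]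
          exact Nat.div_add_mod' k (p - 1) }
    refine dvd_trans ?_ (Finset.dvd_lcm (Finset.mem_univ P))
    have : p - 1 + 1 = p := by omega
    simp only [P, Multiset.map_add, Multiset.map_replicate, Multiset.prod_add,
      Multiset.prod_replicate, this]
    exact dvd_mul_right _ _
end

section
/- For every prime p and every natural number k, the p-adic valuation of the least common multiple, over all partitions λ = (λ_1,…,λ_l) of k, of the products (λ_1+1)!·⋯·(λ_l+1)!, equals ⌊k/(p-1)⌋. -/
lemma aux_prod_ne_zero (s : Multiset ℕ) :
    (s.map (fun i => Nat.factorial (i + 1))).prod ≠ 0 := by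
  apply Multiset.prod_ne_zero
  intro h
  obtain ⟨i, _, hi⟩ := Multiset.mem_map.1 h
  exact Nat.factorial_ne_zero _ hi

lemma aux_upper (p : ℕ) (hp : p.Prime) (s : Multiset ℕ) :
    (p - 1) * padicValNat p (s.map (fun i => Nat.factorial (i + 1))).prod ≤ s.sum := by
  haveI := Fact.mk hp
  induction s using Multiset.induction_on with
  | empty => simp
  | cons a s ih =>
    rw [Multiset.map_cons, Multiset.prod_cons, Multiset.sum_cons,
      padicValNat.mul (Nat.factorial_ne_zero _) (aux_prod_ne_zero s), mul_add]
    have := sub_one_mul_padicValNat_factorial_lt_of_ne_zero p (n := a + 1) (by omega)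
    omega

/-- For every prime `p` and every natural number `k`, the `p`-adic valuation of the
least common multiple over all partitions `λ = (λ₁, …, λ_l)` of `k` of the products
`(λ₁+1)! ⋯ (λ_l+1)!` equals `⌊k/(p-1)⌋`. -/
theorem padicValNat_lcm_factorials (p k : ℕ) (hp : p.Prime) :
    padicValNat p
        ((Finset.univ : Finset (Nat.Partition k)).lcm
          (fun P => (P.parts.map (fun i => Nat.factorial (i + 1))).prod)) =
      k / (p - 1) := by
  haveI := Fact.mk hp
  have hp1 : 0 < p - 1 := by have := hp.two_le; omega
  rw [← Nat.factorization_def _ hp,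
    Finset.factorization_lcm (fun P _ => aux_prod_ne_zero P.parts)]
  apply le_antisymm
  · apply Finset.sup_le
    intro P _
    rw [Nat.factorization_def _ hp, Nat.le_div_iff_mul_le hp1, mul_comm]
    exact (aux_upper p hp P.parts).trans_eq P.parts_sum
  · let P : Nat.Partition k :=
      { parts := Multiset.replicate (k / (p - 1)) (p - 1) + Multiset.replicate (k % (p - 1)) 1
        parts_pos := by
          intro i hi
          rcases Multiset.mem_add.1 hi with h | h
          · rw [Multiset.eq_of_mem_replicate h]; exact hp1
          · rw [Multiset.eq_of_mem_replicate h]; exact one_pos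
        parts_sum := by
          simp only [Multiset.sum_add, Multiset.sum_replicate, smul_eq_mul, mul_one]
          exact Nat.div_add_mod' k (p - 1) }
    refine le_trans ?_ (Finset.le_sup (Finset.mem_univ P))
    rw [← hp.pow_dvd_iff_le_factorization (aux_prod_ne_zero P.parts)]
    simp only [P, Multiset.map_add, Multiset.prod_add, Multiset.map_replicate,
      Multiset.prod_replicate]
    apply Dvd.dvd.mul_right
    rw [Nat.sub_add_cancel hp.one_le]
    exact pow_dvd_pow_of_dvd (Nat.dvd_factorial hp.pos le_rfl) _
end

section
/- For every natural number k, the least common multiple, over all partitions λ = (λ_1,…,λ_l) of k, of the products (2λ_1+1)·(2λ_2+1)·⋯·(2λ_l+1), equals ∏_{p odd prime} p^⌊2k/(p-1)⌋ (this common value is the denominator μ(L_k) of the Hirzebruch L-polynomial L_k). -/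
/-- `μ(L k) = ∏_{p odd prime} p ^ ⌊2k/(p-1)⌋` (odd primes `p > 2k+1` contribute
exponent `0`, so the product is over odd primes `p ≤ 2k+1`): the denominator of the
Hirzebruch `L`-polynomial `L_k`. -/
def muL (k : ℕ) : ℕ :=
  ∏ p ∈ Finset.filter (fun p => p.Prime ∧ Odd p) (Finset.range (2 * k + 2)),
    p ^ (2 * k / (p - 1))

theorem muL_ne_zero (k : ℕ) : muL k ≠ 0 := by
  unfold muL
  refine Finset.prod_ne_zero_iff.2 fun p hp => ?_
  simp only [Finset.mem_filter] at hp
  exact pow_ne_zero _ hp.2.1.ne_zero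

theorem muL_factorization (k p : ℕ) (hp : p.Prime) (ho : Odd p) :
    (muL k).factorization p = 2 * k / (p - 1) := by
  unfold muL
  rw [Nat.factorization_prod_apply]
  · have h : ∀ q ∈ Finset.filter (fun p => p.Prime ∧ Odd p) (Finset.range (2 * k + 2)),
        (q ^ (2 * k / (q - 1))).factorization p = if p = q then 2 * k / (p - 1) else 0 := by
      intro q hq
      simp only [Finset.mem_filter] at hq
      rw [hq.2.1.factorization_pow, Finsupp.single_apply]
      by_cases hpq : p = q
      · simp [hpq]
      · simp [hpq, Ne.symm hpq]
    rw [Finset.sum_congr rfl h, Finset.sum_ite_eq]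
    split_ifs with hm
    · rfl
    · simp only [Finset.mem_filter, Finset.mem_range, hp, ho, and_self, and_true] at hm
      rw [Nat.div_eq_of_lt (by omega)]
  · intro q hq
    simp only [Finset.mem_filter] at hq
    exact pow_ne_zero _ hq.2.1.ne_zero

theorem step_dvd (i j : ℕ) : (2 * i + 1) * muL j ∣ muL (i + j) := by
  have h1 : 2 * i + 1 ≠ 0 := by omega
  rw [← Nat.factorization_prime_le_iff_dvd (mul_ne_zero h1 (muL_ne_zero j)) (muL_ne_zero _)]
  intro p hp
  rw [Nat.factorization_mul h1 (muL_ne_zero j), Finsupp.add_apply]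
  rcases hp.eq_two_or_odd' with rfl | ho
  · have e1 : (2 * i + 1).factorization 2 = 0 :=
      Nat.factorization_eq_zero_of_not_dvd (by omega)
    have e2 : (muL j).factorization 2 = 0 := by
      apply Nat.factorization_eq_zero_of_not_dvd
      unfold muL
      rw [Nat.prime_two.prime.dvd_finsetProd_iff]
      rintro ⟨q, hq, hd⟩
      simp only [Finset.mem_filter] at hq
      have h2 := Nat.prime_two.dvd_of_dvd_pow hd
      have h3 := hq.2.2
      rw [← Nat.not_even_iff_odd, even_iff_two_dvd] at h3
      exact h3 h2
    omega
  · rw [muL_factorization j p hp ho, muL_factorization _ p hp ho]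
    have hp2 := hp.two_le
    have hv : (2 * i + 1).factorization p ≤ 2 * i / (p - 1) := by
      rw [Nat.le_div_iff_mul_le (by omega)]
      have hle : p ^ (2 * i + 1).factorization p ≤ 2 * i + 1 :=
        Nat.le_of_dvd (by omega) (Nat.ordProj_dvd _ _)
      obtain ⟨m, rfl⟩ : ∃ m, p = m + 1 := ⟨p - 1, by omega⟩
      generalize (2 * i + 1).factorization (m + 1) = v at *
      have hb : ∀ v : ℕ, v * m + 1 ≤ (m + 1) ^ v := by
        intro v
        induction v with
        | zero => simp
        | succ v ih => rw [pow_succ]; nlinarith [Nat.zero_le (v * m * m)]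
      have := hb v
      simp only [Nat.add_sub_cancel]
      omega
    calc _ ≤ 2 * i / (p - 1) + 2 * j / (p - 1) := by omega
      _ ≤ (2 * i + 2 * j) / (p - 1) := Nat.div_add_div_le_add_div
      _ = _ := by rw [mul_add]

theorem multiset_dvd (s : Multiset ℕ) : (s.map (fun i => 2 * i + 1)).prod ∣ muL s.sum := by
  induction s using Multiset.induction with
  | empty => simp
  | cons a s ih =>
    rw [Multiset.map_cons, Multiset.prod_cons, Multiset.sum_cons]
    exact (mul_dvd_mul_left _ ih).trans (step_dvd _ _)

theorem prod_filter_ne_zero (s : Multiset ℕ) :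
    ((s.filter (· ≠ 0)).map (fun i => 2 * i + 1)).prod = (s.map (fun i => 2 * i + 1)).prod := by
  induction s using Multiset.induction with
  | empty => simp
  | cons a s ih =>
    by_cases h : a = 0
    · subst h
      simpa using ih
    · rw [Multiset.filter_cons_of_pos (p := (· ≠ 0)) _ h, Multiset.map_cons, Multiset.prod_cons, ih,
        Multiset.map_cons, Multiset.prod_cons]

/-- The least common multiple over all partitions `λ = (λ₁, …, λ_l)` of `k` of the
products `(2λ₁+1) ⋯ (2λ_l+1)` equals `∏_{p odd prime} p ^ ⌊2k/(p-1)⌋`. -/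
theorem lcm_odd_products_eq_muL (k : ℕ) :
    (Finset.univ : Finset (Nat.Partition k)).lcm
        (fun P => (P.parts.map (fun i => 2 * i + 1)).prod) =
      muL k := by
  apply Nat.dvd_antisymm
  · apply Finset.lcm_dvd
    intro P _
    have h := multiset_dvd P.parts
    rwa [P.parts_sum] at h
  · unfold muL
    apply Finset.prod_dvd_of_isRelPrime
    · intro p hp q hq hpq
      simp only [Finset.coe_filter, Set.mem_ofPred_eq] at hp hq
      rw [Function.onFun, ← Nat.coprime_iff_isRelPrime]
      exact Nat.Coprime.pow _ _ ((Nat.coprime_primes hp.2.1 hq.2.1).2 hpq)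
    · intro p hp
      simp only [Finset.mem_filter] at hp
      obtain ⟨m, rfl⟩ := hp.2.2
      have hq : 2 * k / (2 * m + 1 - 1) = k / m := by
        rw [Nat.add_sub_cancel, Nat.mul_div_mul_left _ _ (by omega)]
      rw [hq]
      have hsum : ((k % m) ::ₘ Multiset.replicate (k / m) m).sum = k := by
        rw [Multiset.sum_cons, Multiset.sum_replicate, smul_eq_mul, mul_comm]
        exact Nat.mod_add_div k m
      refine dvd_trans ?_ (Finset.dvd_lcm (Finset.mem_univ (Nat.Partition.ofSums k _ hsum)))
      simp only [Nat.Partition.ofSums]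
      rw [prod_filter_ne_zero, Multiset.map_cons, Multiset.prod_cons, Multiset.map_replicate,
        Multiset.prod_replicate]
      exact dvd_mul_left _ _
end

section
/- For every natural number k, the Bernoulli number B_k (with the convention x/(e^x−1) = Σ_n B_n x^n/n!, so B_1 = −1/2) is given by the sum over all partitions λ = (λ_1,…,λ_l) of k: B_k = k! · Σ_{λ ⊢ k} (−1)^{l(λ)} N(λ) / ((λ_1+1)!·⋯·(λ_l+1)!), where l(λ) is the number of parts of λ and N(λ) = l(λ)! / (m_1(λ)!·m_2(λ)!·⋯) is the number of distinct permutations of the sequence (λ_1,…,λ_l), with m_j(λ) the number of parts of λ equal to j. -/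
/-- `N(λ) = l(λ)! / (m₁(λ)!·m₂(λ)!·⋯)`: the number of distinct permutations of the
sequence `(λ₁, …, λ_l)`, where `m_j(λ)` is the number of parts of `λ` equal to `j`. -/
def numPerms {k : ℕ} (P : Nat.Partition k) : ℕ :=
  Nat.factorial (Multiset.card P.parts) /
    ∏ j ∈ P.parts.toFinset, Nat.factorial (P.parts.count j)

section
open Finset
def wt (s : Multiset ℕ) : ℚ :=
  (-1 : ℚ) ^ (Multiset.card s) * ((Multiset.card s).factorial : ℚ) /
    ((∏ j ∈ s.toFinset, (s.count j).factorial : ℕ) : ℚ) /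
    (((s.map (fun i => Nat.factorial (i + 1))).prod : ℕ) : ℚ)

lemma wt_cons (a : ℕ) (t : Multiset ℕ) :
    wt t * (-1 / ((a+1).factorial : ℚ)) = wt (a ::ₘ t) * ((a ::ₘ t).count a : ℚ) / (Multiset.card (a ::ₘ t) : ℚ) := by
  have h1 : (∏ j ∈ (a ::ₘ t).toFinset, ((a ::ₘ t).count j).factorial : ℕ)
      = (t.count a + 1) * ∏ j ∈ t.toFinset, (t.count j).factorial := by
    have e1 : (∏ j ∈ t.toFinset, (t.count j).factorial)
        = ∏ j ∈ (a ::ₘ t).toFinset, (t.count j).factorial := by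
      apply Finset.prod_subset
      · intro x hx; simp at hx ⊢; exact Or.inr hx
      · intro x _ hx
        simp at hx
        simp [hx]
    have ha : a ∈ (a ::ₘ t).toFinset := by simp
    rw [e1, ← Finset.mul_prod_erase _ _ ha, ← Finset.mul_prod_erase _ _ ha, ← mul_assoc]
    congr 1
    · simp [Nat.factorial_succ]
    · apply Finset.prod_congr rfl
      intro x hx
      rw [Multiset.count_cons_of_ne (Finset.ne_of_mem_erase hx)]
  unfold wt
  rw [h1]
  have h2 : ((∏ j ∈ t.toFinset, (t.count j).factorial : ℕ) : ℚ) ≠ 0 := by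
    exact_mod_cast Finset.prod_ne_zero_iff.2 fun x _ => Nat.factorial_ne_zero _
  have h3 : (((t.map (fun i => Nat.factorial (i + 1))).prod : ℕ) : ℚ) ≠ 0 := by
    norm_cast
    apply Multiset.prod_ne_zero
    simp [Nat.factorial_ne_zero]
  have h4 : ((a+1).factorial : ℚ) ≠ 0 := by exact_mod_cast Nat.factorial_ne_zero _
  have h5 : ((Multiset.card t : ℚ) + 1) ≠ 0 := by positivity
  have h6 : ((t.count a : ℚ) + 1) ≠ 0 := by positivity
  rw [Multiset.card_cons, Multiset.map_cons, Multiset.prod_cons, Multiset.count_cons_self,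
    Nat.factorial_succ (Multiset.card t), pow_succ]
  rw [Nat.cast_mul, Nat.cast_mul, Nat.cast_mul, Nat.cast_succ, Nat.cast_succ]
  field_simp

lemma wt_rec (s : Multiset ℕ) (hs : s ≠ 0) :
    wt s = ∑ a ∈ s.toFinset, wt (s.erase a) * (-1 / ((a+1).factorial : ℚ)) := by
  have : ∀ a ∈ s.toFinset, wt (s.erase a) * (-1 / ((a+1).factorial : ℚ))
      = wt s * (s.count a : ℚ) / (Multiset.card s : ℚ) := by
    intro a ha
    have := wt_cons a (s.erase a)
    rwa [Multiset.cons_erase (by simpa using ha)] at this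
  rw [Finset.sum_congr rfl this, ← Finset.sum_div, ← Finset.mul_sum, ← Nat.cast_sum,
    Multiset.toFinset_sum_count_eq]
  have : (Multiset.card s : ℚ) ≠ 0 := by
    exact_mod_cast fun h => hs (Multiset.card_eq_zero.1 h)
  field_simp

lemma sum_wt_rec (k : ℕ) (hk : k ≠ 0) :
    ∑ P : Nat.Partition k, wt P.parts
      = ∑ a ∈ Icc 1 k, (∑ Q : Nat.Partition (k - a), wt Q.parts) * (-1 / ((a+1).factorial : ℚ)) := by
  have h0 : ∀ P : Nat.Partition k, wt P.parts = ∑ a ∈ Icc 1 k,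
      if a ∈ P.parts then wt (P.parts.erase a) * (-1 / ((a+1).factorial : ℚ)) else 0 := by
    intro P
    have hP : P.parts ≠ 0 := by
      intro h
      have := P.parts_sum
      rw [h] at this
      simp at this
      omega
    rw [wt_rec _ hP, ← Finset.sum_filter]
    apply Finset.sum_congr _ fun _ _ => rfl
    ext a
    simp only [Multiset.mem_toFinset, mem_filter, mem_Icc]
    exact ⟨fun h => ⟨⟨P.parts_pos h, P.le_of_mem_parts h⟩, h⟩, fun h => h.2⟩
  rw [Finset.sum_congr rfl fun P _ => h0 P, Finset.sum_comm]
  apply Finset.sum_congr rfl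
  intro a ha
  rw [mem_Icc] at ha
  rw [← Finset.sum_filter, Finset.sum_mul]
  have inst : Fintype {P : Nat.Partition k // a ∈ P.parts} := Fintype.ofFinite _
  rw [Finset.sum_subtype (F := inst) (p := fun P : Nat.Partition k => a ∈ P.parts) _ (by simp)]
  rw [← (Nat.Partition.partitionWithPartEquiv ha.1 ha.2).sum_comp]
  simp

lemma bern_rec (k : ℕ) (hk : k ≠ 0) :
    bernoulli k / (k.factorial : ℚ)
      = ∑ a ∈ Icc 1 k, (bernoulli (k - a) / ((k-a).factorial : ℚ)) * (-1 / ((a+1).factorial : ℚ)) := by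
  have h := sum_bernoulli (k+1)
  rw [if_neg (by omega), ← Finset.sum_range_reflect, Finset.sum_range_succ'] at h
  have e : ∑ a ∈ Icc 1 k, (bernoulli (k - a) / ((k-a).factorial : ℚ)) * (-1 / ((a+1).factorial : ℚ))
    = - (∑ j ∈ range k, ((k+1).choose (k+1-1-(j+1)) : ℚ) * bernoulli (k+1-1-(j+1))) / ((k+1).factorial : ℚ) := by
    rw [← Finset.sum_neg_distrib, Finset.sum_div, Finset.range_eq_Ico, Finset.sum_Ico_add' (fun j => -(((k+1).choose (k+1-1-j) : ℚ) * bernoulli (k+1-1-j)) / ((k+1).factorial : ℚ)) 0 k 1]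
    apply Finset.sum_congr (by ext; simp only [mem_Icc, mem_Ico]; omega)
    intro a ha
    have ha' : a ≤ k := by simp at ha; omega
    rw [Nat.add_sub_cancel, Nat.cast_choose ℚ (by omega : k - a ≤ k + 1),
      show k + 1 - (k - a) = a + 1 by omega]
    have h4 := Nat.factorial_ne_zero (a+1)
    have h5 := Nat.factorial_ne_zero (k-a)
    have h6 := Nat.factorial_ne_zero (k+1)
    field_simp
  rw [e, eq_neg_of_add_eq_zero_left h]
  simp [Nat.factorial_succ]
  have h6 := Nat.factorial_ne_zero k
  field_simp

lemma main_aux (k : ℕ) : bernoulli k / (k.factorial : ℚ) = ∑ P : Nat.Partition k, wt P.parts := by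
  induction k using Nat.strong_induction_on with
  | _ k ih =>
    rcases eq_or_ne k 0 with rfl | hk
    · simp [wt]
    · rw [bern_rec k hk, sum_wt_rec k hk]
      apply Finset.sum_congr rfl
      intro a ha
      rw [mem_Icc] at ha
      rw [ih (k-a) (by omega)]

end

/-- The Bernoulli number `B_k` (with the convention `x/(eˣ−1) = Σ B_n xⁿ/n!`, so
`B₁ = −1/2`, i.e. Mathlib's `bernoulli`) is given by the sum over all partitions
`λ = (λ₁, …, λ_l)` of `k`:
`B_k = k! · Σ_{λ ⊢ k} (−1)^{l(λ)} N(λ) / ((λ₁+1)!·⋯·(λ_l+1)!)`. -/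
theorem bernoulli_eq_sum_over_partitions (k : ℕ) :
    bernoulli k =
      (Nat.factorial k : ℚ) *
        ∑ P : Nat.Partition k,
          (-1 : ℚ) ^ (Multiset.card P.parts) * (numPerms P : ℚ) /
            (((P.parts.map (fun i => Nat.factorial (i + 1))).prod : ℕ) : ℚ) := by
  have key : ∀ P : Nat.Partition k, (-1 : ℚ) ^ (Multiset.card P.parts) * (numPerms P : ℚ) /
            (((P.parts.map (fun i => Nat.factorial (i + 1))).prod : ℕ) : ℚ) = wt P.parts := by
    intro P
    unfold numPerms wt
    have hd : (∏ j ∈ P.parts.toFinset, Nat.factorial (P.parts.count j)) ∣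
        Nat.factorial (Multiset.card P.parts) := by
      rw [← Multiset.toFinset_sum_count_eq]
      exact Nat.prod_factorial_dvd_factorial_sum _ _
    rw [Nat.cast_div_charZero hd, mul_div_assoc]
    ring
  rw [Finset.sum_congr rfl fun P _ => key P, ← main_aux]
  have h6 := Nat.factorial_ne_zero k
  field_simp
end

section
/- For every natural number k, the denominator of the Bernoulli number B_k (written in lowest terms, with the convention B_1 = −1/2) divides the Hirzebruch number h_k = ∏_{p prime} p^⌊k/(p-1)⌋. -/
lemma prime_dvd_hirz {k p : ℕ} (hp : p.Prime) (h : p < k + 2) : p ∣ hirzebruch k := by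
  unfold hirzebruch
  refine dvd_trans (dvd_pow_self p ?_) (Finset.dvd_prod_of_mem _ (by simp [hp, h]))
  have := hp.two_le
  exact (Nat.div_pos (by omega) (by omega)).ne'

lemma den_dvd_of_mul_int (q : ℚ) (h : ℕ) (z : ℤ) (e : q * h = z) : q.den ∣ h := by
  have h1 : q.num * h = z * q.den := by
    have hq : (q.num : ℚ) = q * q.den := (Rat.mul_den_eq_num q).symm
    have : (q.num : ℚ) * h = z * q.den := by rw [hq, ← e]; ring
    exact_mod_cast this
  have h2 : (q.den : ℤ) ∣ q.num * h := ⟨z, by rw [h1]; ring⟩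
  have h3 : IsCoprime (q.den : ℤ) q.num := by
    rw [Int.isCoprime_iff_gcd_eq_one, Int.gcd_comm]
    simpa [Int.gcd] using q.reduced
  exact_mod_cast h3.dvd_of_dvd_mul_left h2

/-- The denominator of the Bernoulli number `B_k` (in lowest terms, with the convention
`B₁ = −1/2`, i.e. Mathlib's `bernoulli`) divides the Hirzebruch number `h k`. -/
theorem bernoulli_den_dvd_hirzebruch (k : ℕ) :
    (bernoulli k).den ∣ hirzebruch k := by
  rcases Nat.even_or_odd' k with ⟨m, rfl | rfl⟩
  · obtain ⟨n, hn⟩ := Bernoulli.vonStaudt_clausen m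
    have key : ∀ p ∈ (Finset.range (2 * m + 2)).filter (fun p => p.Prime ∧ (p - 1) ∣ 2 * m),
        (1 / (p : ℚ)) * hirzebruch (2 * m) = ((hirzebruch (2 * m) / p : ℕ) : ℚ) := by
      intro p hp
      simp only [Finset.mem_filter, Finset.mem_range] at hp
      rw [Nat.cast_div (prime_dvd_hirz hp.2.1 hp.1) (by exact_mod_cast hp.2.1.ne_zero)]
      ring
    have hs := Finset.sum_congr rfl key
    rw [← Finset.sum_mul] at hs
    apply den_dvd_of_mul_int _ _ (n * hirzebruch (2 * m) - ∑ p ∈ (Finset.range (2 * m + 2)).filter (fun p => p.Prime ∧ (p - 1) ∣ 2 * m), ((hirzebruch (2 * m) / p : ℕ) : ℤ))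
    simp only [Int.cast_sub, Int.cast_mul, Int.cast_sum, Int.cast_natCast]
    rw [← hs]
    rw [hn]; ring
  · rcases Nat.eq_zero_or_pos m with rfl | hm
    · have : (bernoulli (2 * 0 + 1)).den = 2 := by
        simp only [mul_zero, zero_add, bernoulli_one]; norm_num
      rw [this]
      exact prime_dvd_hirz Nat.prime_two (by norm_num)
    · rw [bernoulli_eq_zero_of_odd ⟨m, rfl⟩ (by omega)]
      simp
end
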